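/- Consider decentralized diffusion iterates x_{k,i+1} = Σ_ℓ a_{kℓ}(x_{ℓ,i} − μ_x u^x_{ℓ,i}/‖u^x_{ℓ,i}‖), y_{k,i+1} = Σ_ℓ a_{kℓ}(y_{ℓ,i} + μ_y u^y_{ℓ,i}/‖u^y_{ℓ,i}‖) with A doubly stochastic, all u-vectors nonzero, each J_k L_f-smooth, J = (1/K)Σ_k J_k satisfying the ν-PL assumption with P attained, and μ_x ≤ μ_y/(6κ). Define Δ_{c,i} := P(x_{c,i}) − J(x_{c,i}, y_{c,i}). Then for every round i: dist(y_{c,i+1}, Y*(x_{c,i+1})) ≤ (1/2)·dist(y_{c,i}, Y*(x_{c,i})) + 3(Δ_{c,i} − Δ_{c,i+1})/(μ_y·ν) + (9κ/√K)·Ξ_i + (9/ν)·‖u^y_{c,i} − (1/K)Σ_{k=1}^K ∇_y J_k(x_{k,i},y_{k,i})‖ + (9/(√K·ν))·‖U^y_i − U^y_{c,i}‖ + (3κ·μ_y/2 + μ_x/4 + 19κ·μ_x/2 + μ_y). -/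

import Mathlib

open scoped RealInnerProductSpace BigOperators

/-- The envelope function `P(x) = sup_y J(x,y)`. -/
noncomputable def Penv {α β : Type*} (J : α → β → ℝ) (x : α) : ℝ := ⨆ y, J x y

/-- The set of maximizers `Y*(x) = argmax_y J(x,y)`. -/
def argmaxY {α β : Type*} (J : α → β → ℝ) (x : α) : Set β := {y | ∀ y', J x y' ≤ J x y}

/-- The centroid `(1/K)·Σ_k v_k` of a family of vectors. -/
noncomputable def centroid {K : ℕ} {E : Type*} [AddCommMonoid E] [Module ℝ E]
    (v : Fin K → E) : E := (K : ℝ)⁻¹ • ∑ k, v k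

/-- `‖V − W‖` for stacked (concatenated) vectors: `√(Σ_k ‖v_k − w_k‖²)`. -/
noncomputable def stackDist {K : ℕ} {E : Type*} [NormedAddCommGroup E]
    (v w : Fin K → E) : ℝ := Real.sqrt (∑ k, ‖v k - w k‖ ^ 2)

/-- Network disagreement norm `‖V − V_c‖` of a family of vectors. -/
noncomputable def consensus {K : ℕ} {E : Type*} [NormedAddCommGroup E] [Module ℝ E]
    (v : Fin K → E) : ℝ := stackDist v (fun _ => centroid v)

section ErrorBound

variable {F : Type*} [NormedAddCommGroup F] [InnerProductSpace ℝ F] [CompleteSpace F]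

theorem HasGradientAt.hasDerivAt_comp_line {f : F → ℝ} {g : F} {z v : F} {t : ℝ}
    (h : HasGradientAt f g (z + t • v)) :
    HasDerivAt (fun s : ℝ => f (z + s • v)) ⟪g, v⟫ t := by
  have h1 : HasDerivAt (fun s : ℝ => z + s • v) v t := by
    simpa using ((hasDerivAt_id t).smul_const v).const_add z
  simpa [Function.comp_def] using h.hasFDerivAt.comp_hasDerivAt t h1

/-- Ekeland-type estimate: a Polyak–Łojasiewicz function grows at least linearly, in square root,
with the distance to its maximizers. -/
theorem mul_infDist_le_sqrt_of_polyak [ProperSpace F] {f : F → ℝ} {g : F → F} {m ν c : ℝ}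
    (hf : ∀ z, HasGradientAt f (g z) z) (hm : ∀ z, f z ≤ m)
    (hPL : ∀ z, 2 * ν * (m - f z) ≤ ‖g z‖ ^ 2) (hc : 0 < c) (hcν : 2 * c ^ 2 < ν) (y : F) :
    c * Metric.infDist y {z | ∀ w, f w ≤ f z} ≤ √(m - f y) := by
  have hfc : Continuous f := continuous_iff_continuousAt.2 fun z => (hf z).continuousAt
  have hcont : Continuous fun z => √(m - f z) + c * dist z y := by fun_prop
  have hlim : Filter.Tendsto (fun z => √(m - f z) + c * dist z y) (Filter.cocompact F)
      Filter.atTop :=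
    Filter.tendsto_atTop_mono (fun z => le_add_of_nonneg_left (Real.sqrt_nonneg _))
      ((tendsto_dist_right_cocompact_atTop y).const_mul_atTop hc)
  obtain ⟨z, hz⟩ := hcont.exists_forall_le hlim
  have hzm : f z = m := by
    by_contra hne
    have hpos : 0 < m - f z := sub_pos.2 (lt_of_le_of_ne (hm z) hne)
    set φ := √(m - f z) with hφ
    have hφpos : 0 < φ := Real.sqrt_pos.2 hpos
    have hφsq : φ ^ 2 = m - f z := Real.sq_sqrt hpos.le
    have hPLz := hPL z
    rw [← hφsq] at hPLz
    have hνpos : 0 < ν := by nlinarith [sq_nonneg c]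
    have hgpos : 0 < ‖g z‖ := by
      by_contra h0
      have h0 : ‖g z‖ = 0 := le_antisymm (not_lt.1 h0) (norm_nonneg _)
      rw [h0] at hPLz
      have : 0 < 2 * ν * φ ^ 2 := by positivity
      linarith
    have hd : HasDerivAt (fun t : ℝ => f (z + t • g z)) ⟪g z, g z⟫ 0 :=
      HasGradientAt.hasDerivAt_comp_line (by simpa using hf z)
    have hd' : HasDerivAt (fun t : ℝ => √(m - f (z + t • g z)) + t * (c * ‖g z‖))
        (-⟪g z, g z⟫ / (2 * φ) + c * ‖g z‖) 0 := by
      have h1 := (hd.const_sub m).sqrt (by simpa using hpos.ne')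
      have h2 := h1.fun_add ((hasDerivAt_id (0 : ℝ)).mul_const (c * ‖g z‖))
      simpa [hφ] using h2
    have hnn : 0 ≤ -⟪g z, g z⟫ / (2 * φ) + c * ‖g z‖ := by
      refine ge_of_tendsto hd'.tendsto_slope_zero_right ?_
      filter_upwards [self_mem_nhdsWithin] with t ht
      have ht : 0 < t := ht
      have h1 := hz (z + t • g z)
      have h2 : dist (z + t • g z) y ≤ dist z y + t * ‖g z‖ := by
        calc dist (z + t • g z) y ≤ dist (z + t • g z) z + dist z y := dist_triangle _ _ _
          _ = dist z y + t * ‖g z‖ := by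
            rw [dist_self_add_left, norm_smul, Real.norm_of_nonneg ht.le, add_comm]
      have h3 := mul_le_mul_of_nonneg_left h2 hc.le
      refine smul_nonneg (inv_nonneg.2 ht.le) ?_
      simp only [zero_add, zero_smul, add_zero, zero_mul]
      linarith
    rw [real_inner_self_eq_norm_sq] at hnn
    have h4 : ‖g z‖ ^ 2 / (2 * φ) ≤ c * ‖g z‖ := by
      rw [neg_div] at hnn; linarith
    rw [div_le_iff₀ (by positivity)] at h4
    have h5 : ‖g z‖ ≤ 2 * c * φ := by
      by_contra! h
      nlinarith
    have h6 : ‖g z‖ ^ 2 ≤ (2 * c * φ) ^ 2 := by gcongr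
    have h7 : 0 < (ν - 2 * c ^ 2) * φ ^ 2 := mul_pos (by linarith) (by positivity)
    nlinarith
  have hzmem : z ∈ {z | ∀ w, f w ≤ f z} := fun w => hzm ▸ hm w
  have h1 := Metric.infDist_le_dist_of_mem (x := y) hzmem
  have h2 := hz y
  simp only [hzm, sub_self, Real.sqrt_zero, zero_add, dist_self, mul_zero, add_zero] at h2
  rw [dist_comm] at h1
  exact (mul_le_mul_of_nonneg_left h1 hc.le).trans h2

/-- The Polyak–Łojasiewicz condition implies the error bound with the same constant. -/
theorem mul_infDist_le_norm_gradient_of_polyak [ProperSpace F] {f : F → ℝ} {g : F → F} {m ν : ℝ}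
    (hν : 0 < ν) (hf : ∀ z, HasGradientAt f (g z) z) (hm : ∀ z, f z ≤ m)
    (hPL : ∀ z, 2 * ν * (m - f z) ≤ ‖g z‖ ^ 2) (y : F) :
    ν * Metric.infDist y {z | ∀ w, f w ≤ f z} ≤ ‖g y‖ := by
  set d := Metric.infDist y {z | ∀ w, f w ≤ f z} with hd
  have hd0 : 0 ≤ d := Metric.infDist_nonneg
  have hs : √(ν / 2) * d ≤ √(m - f y) := by
    by_contra! h
    have hdpos : 0 < d := by
      by_contra h0
      rw [le_antisymm (not_lt.1 h0) hd0, mul_zero] at h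
      exact absurd h (not_lt.2 (Real.sqrt_nonneg _))
    obtain ⟨c, hc1, hc2⟩ := exists_between ((div_lt_iff₀ hdpos).2 h)
    have hc : 0 < c := (by positivity : 0 ≤ √(m - f y) / d).trans_lt hc1
    have hcν : 2 * c ^ 2 < ν := by
      have := (Real.lt_sqrt hc.le).1 hc2
      linarith
    have := mul_infDist_le_sqrt_of_polyak hf hm hPL hc hcν y
    rw [div_lt_iff₀ hdpos] at hc1
    linarith
  have h1 : (√(ν / 2) * d) ^ 2 ≤ √(m - f y) ^ 2 := by gcongr
  rw [mul_pow, Real.sq_sqrt (by positivity), Real.sq_sqrt (sub_nonneg.2 (hm y))] at h1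
  refine abs_le_of_sq_le_sq' ?_ (norm_nonneg _) |>.2
  have := hPL y
  nlinarith

/-- Quadratic lower bound for a function with Lipschitz gradient. -/
theorem inner_sub_le_of_lipschitz_gradient {f : F → ℝ} {g : F → F} {L : ℝ}
    (hf : ∀ z, HasGradientAt f (g z) z) (hL : ∀ z w, ‖g z - g w‖ ≤ L * ‖z - w‖) (z v : F) :
    ⟪g z, v⟫ - L / 2 * ‖v‖ ^ 2 ≤ f (z + v) - f z := by
  set h : ℝ → ℝ := fun t => f (z + t • v) - t * ⟪g z, v⟫ + t ^ 2 * (L / 2 * ‖v‖ ^ 2)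
  have hd : ∀ t, HasDerivAt h (⟪g (z + t • v), v⟫ - ⟪g z, v⟫ + 2 * t * (L / 2 * ‖v‖ ^ 2)) t := by
    intro t
    have h1 := (hf (z + t • v)).hasDerivAt_comp_line
    have h2 := (h1.fun_sub ((hasDerivAt_id t).mul_const ⟪g z, v⟫)).fun_add
      ((hasDerivAt_pow 2 t).mul_const (L / 2 * ‖v‖ ^ 2))
    simpa using h2
  have hmono : MonotoneOn h (Set.Ici 0) := by
    refine monotoneOn_of_deriv_nonneg (convex_Ici 0)
      (fun t _ => (hd t).continuousAt.continuousWithinAt)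
      (fun t _ => (hd t).differentiableAt.differentiableWithinAt) fun t ht => ?_
    rw [interior_Ici] at ht
    have ht : 0 < t := ht
    rw [(hd t).deriv]
    have h1 : |⟪g (z + t • v) - g z, v⟫| ≤ ‖g (z + t • v) - g z‖ * ‖v‖ := abs_real_inner_le_norm _ _
    have h2 : ‖g (z + t • v) - g z‖ ≤ L * (t * ‖v‖) := by
      have := hL (z + t • v) z
      rwa [add_sub_cancel_left, norm_smul, Real.norm_of_nonneg ht.le] at this
    have h3 := mul_le_mul_of_nonneg_right h2 (norm_nonneg v)
    rw [inner_sub_left] at h1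
    have := (abs_le.1 h1).1
    nlinarith
  have := hmono (Set.mem_Ici.2 le_rfl) (Set.mem_Ici.2 zero_le_one) zero_le_one
  simp only [h, zero_smul, add_zero, zero_mul, sub_zero, one_smul, one_mul, ne_eq,
    OfNat.ofNat_ne_zero, not_false_eq_true, zero_pow, one_pow] at this
  linarith

end ErrorBound

theorem norm_sub_two_mul_le_inner_normalized {F : Type*} [NormedAddCommGroup F]
    [InnerProductSpace ℝ F] {g u : F} (hu : u ≠ 0) :
    ‖g‖ - 2 * ‖u - g‖ ≤ ⟪g, ‖u‖⁻¹ • u⟫ := by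
  have hu' : 0 < ‖u‖ := norm_pos_iff.2 hu
  have h1 : ⟪g, ‖u‖⁻¹ • u⟫ = ‖u‖ - ⟪u - g, ‖u‖⁻¹ • u⟫ := by
    rw [inner_sub_left, inner_smul_right u u, real_inner_self_eq_norm_sq]
    field_simp
    ring
  have h2 : ⟪u - g, ‖u‖⁻¹ • u⟫ ≤ ‖u - g‖ := by
    refine (real_inner_le_norm _ _).trans_eq ?_
    rw [norm_smul, norm_inv, norm_norm, inv_mul_cancel₀ hu'.ne', mul_one]
  have h3 : ‖g‖ - ‖u‖ ≤ ‖u - g‖ := by rw [norm_sub_rev]; exact norm_sub_norm_le _ _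
  linarith

/-- Second differences of a function with Lipschitz partial gradient in the first variable. -/
theorem abs_mixed_difference_le {E F : Type*} [NormedAddCommGroup E] [InnerProductSpace ℝ E]
    [CompleteSpace E] [NormedAddCommGroup F] {J : E → F → ℝ} {gx : E → F → E} {L : ℝ}
    (hgx : ∀ x y, HasGradientAt (fun w => J w y) (gx x y) x)
    (hL : ∀ x y z, ‖gx x y - gx x z‖ ≤ L * ‖y - z‖) (x x' : E) (y z : F) :
    |(J x' y - J x' z) - (J x y - J x z)| ≤ L * ‖y - z‖ * ‖x' - x‖ := by
  refine convex_univ.norm_image_sub_le_of_norm_hasFDerivWithin_le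
    (f := fun w => J w y - J w z)
    (f' := fun w => InnerProductSpace.toDual ℝ E (gx w y) - InnerProductSpace.toDual ℝ E (gx w z))
    (fun w _ => ((hgx w y).hasFDerivAt.sub (hgx w z).hasFDerivAt).hasFDerivWithinAt)
    (fun w _ => ?_) (Set.mem_univ x) (Set.mem_univ x')
  rw [← map_sub, LinearIsometryEquiv.norm_map]
  exact hL w y z

section Envelope

variable {E F : Type*} [NormedAddCommGroup E] [InnerProductSpace ℝ E] [CompleteSpace E]
  [NormedAddCommGroup F] [InnerProductSpace ℝ F] [CompleteSpace F]

theorem Penv_eq_of_mem_argmaxY {α β : Type*} {J : α → β → ℝ} {x : α} {y : β}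
    (h : y ∈ argmaxY J x) : Penv J x = J x y :=
  have : Nonempty β := ⟨y⟩
  le_antisymm (ciSup_le h) (le_ciSup (f := J x) ⟨J x y, by rintro _ ⟨z, rfl⟩; exact h z⟩ y)

/-- Optimality-gap recursion for one ascent–descent step `(x, y) ↦ (x', y')`, where the ascent
direction correlates with the partial gradient at `(x, y)` up to the error `e`. -/
theorem infDist_argmaxY_step [ProperSpace F] {J : E → F → ℝ} {gx : E → F → E} {gy : E → F → F}
    {L ν μx μy e : ℝ} (hL : 0 < L) (hν : 0 < ν) (hμy : 0 < μy)
    (hgx : ∀ x y, HasGradientAt (fun w => J w y) (gx x y) x)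
    (hgy : ∀ x y, HasGradientAt (fun w => J x w) (gy x y) y)
    (hLx : ∀ x y z, ‖gx x y - gx x z‖ ≤ L * ‖y - z‖)
    (hLyx : ∀ x z y, ‖gy x y - gy z y‖ ≤ L * ‖x - z‖)
    (hLy : ∀ x y z, ‖gy x y - gy x z‖ ≤ L * ‖y - z‖)
    (hattain : ∀ x, (argmaxY J x).Nonempty)
    (hPL : ∀ x y, 2 * ν * (Penv J x - J x y) ≤ ‖gy x y‖ ^ 2)
    (hstep : μx ≤ μy / (6 * (L / ν))) {x x' : E} {y y' : F}
    (hx : ‖x' - x‖ ≤ μx) (hy : ‖y' - y‖ ≤ μy)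
    (hcorr : ∀ g, μy * (‖g‖ - 2 * (e + ‖gy x y - g‖)) ≤ ⟪g, y' - y⟫) :
    Metric.infDist y' (argmaxY J x') ≤
      1 / 2 * Metric.infDist y (argmaxY J x)
        + 3 * ((Penv J x - J x y) - (Penv J x' - J x' y')) / (μy * ν)
        + 6 * e / ν + (3 * (L / ν) * μy / 2 + 6 * (L / ν) * μx + μy) := by
  have hle : ∀ x y, J x y ≤ Penv J x := fun x y => by
    obtain ⟨z, hz⟩ := hattain x
    rw [Penv_eq_of_mem_argmaxY hz]; exact hz y
  have hEB : ∀ x y, ν * Metric.infDist y (argmaxY J x) ≤ ‖gy x y‖ := fun x y =>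
    mul_infDist_le_norm_gradient_of_polyak hν (hgy x) (hle x) (hPL x) y
  have hclosed : IsClosed (argmaxY J x') := by
    have hc : Continuous (J x') := continuous_iff_continuousAt.2 fun z => (hgy x' z).continuousAt
    have : argmaxY J x' = ⋂ w, {z | J x' w ≤ J x' z} := by ext; simp [argmaxY]
    rw [this]
    exact isClosed_iInter fun w => isClosed_le continuous_const hc
  obtain ⟨p, hp, hpd⟩ := hclosed.exists_infDist_eq_dist (hattain x') y
  set d := Metric.infDist y (argmaxY J x') with hd
  have hd0 : 0 ≤ d := Metric.infDist_nonneg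
  have hδ : Metric.infDist y' (argmaxY J x') ≤ d + μy := by
    refine (Metric.infDist_le_infDist_add_dist (y := y)).trans ?_
    rw [dist_eq_norm]; linarith
  have hmix := (abs_le.1 (abs_mixed_difference_le hgx hLx x x' y p)).1
  rw [← dist_eq_norm y p, ← hpd] at hmix
  have hμx : 0 ≤ μx := (norm_nonneg _).trans hx
  have hmix' : L * d * ‖x' - x‖ ≤ L * d * μx := by gcongr
  have hasc := inner_sub_le_of_lipschitz_gradient (hgy x') (hLy x') y (y' - y)
  rw [add_sub_cancel] at hasc
  have hc := hcorr (gy x' y)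
  have hs : L / 2 * ‖y' - y‖ ^ 2 ≤ L / 2 * μy ^ 2 := by gcongr
  have hg : ‖gy x y - gy x' y‖ ≤ L * μx := by
    refine (hLyx x x' y).trans ?_
    rw [norm_sub_rev]; gcongr
  have hPx := hle x p
  have hPx' := Penv_eq_of_mem_argmaxY hp
  have hstep' : 6 * L * μx ≤ μy * ν := by
    have h : μx * (6 * (L / ν)) ≤ μy := (le_div_iff₀ (by positivity)).1 hstep
    have h' : μx * (6 * (L / ν)) * ν ≤ μy * ν := by gcongr
    have : μx * (6 * (L / ν)) * ν = 6 * L * μx := by field_simp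
    linarith
  have hc' : μy * (ν * d - 2 * (e + L * μx)) ≤ ⟪gy x' y, y' - y⟫ := by
    refine le_trans ?_ hc
    have := hEB x' y
    gcongr
  have hgap : μy * ν * d - 2 * μy * (e + L * μx) - L / 2 * μy ^ 2 - L * d * μx ≤
      (Penv J x - J x y) - (Penv J x' - J x' y') := by
    rw [hPx']; linarith
  have hgap' : 5 / 2 * d - 6 * e / ν - (3 * (L / ν) * μy / 2 + 6 * (L / ν) * μx) ≤
      3 * ((Penv J x - J x y) - (Penv J x' - J x' y')) / (μy * ν) := by
    rw [le_div_iff₀ (by positivity)]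
    have hexp : (5 / 2 * d - 6 * e / ν - (3 * (L / ν) * μy / 2 + 6 * (L / ν) * μx)) * (μy * ν) =
        5 / 2 * d * (μy * ν) - 6 * μy * e - (3 / 2 * L * μy ^ 2 + 6 * L * μx * μy) := by
      field_simp
    have h6 : d * (6 * L * μx) ≤ d * (μy * ν) := by gcongr
    rw [hexp]; linarith
  have := Metric.infDist_nonneg (x := y) (s := argmaxY J x)
  linarith

end Envelope

section Network

variable {K : ℕ} {E : Type*} [NormedAddCommGroup E]

theorem stackDist_nonneg (v w : Fin K → E) : 0 ≤ stackDist v w := Real.sqrt_nonneg _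

/-- Averages of norms are controlled by the stacked norm. -/
theorem inv_mul_sum_norm_le_stackDist (hK : 0 < K) (v w : Fin K → E) :
    (K : ℝ)⁻¹ * ∑ k, ‖v k - w k‖ ≤ stackDist v w / √K := by
  have hK' : (0 : ℝ) < K := by exact_mod_cast hK
  have h1 : ∑ k, ‖v k - w k‖ ≤ √K * stackDist v w := by
    rw [stackDist, ← Real.sqrt_mul hK'.le]
    refine Real.le_sqrt_of_sq_le ?_
    simpa using sq_sum_le_card_mul_sum_sq (s := Finset.univ) (f := fun k => ‖v k - w k‖)
  have h2 : √(K : ℝ) * √K = K := Real.mul_self_sqrt hK'.le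
  have h3 : 0 < √(K : ℝ) := Real.sqrt_pos.2 hK'
  rw [inv_mul_le_iff₀ hK']
  refine h1.trans_eq ?_
  nth_rw 2 [← h2]
  field_simp

variable [NormedSpace ℝ E]

theorem centroid_doublyStochastic (A : Matrix (Fin K) (Fin K) ℝ) (hAcol : ∀ l, ∑ k, A k l = 1)
    (v : Fin K → E) : (centroid fun k => ∑ l, A k l • v l) = centroid v := by
  simp only [centroid]
  rw [Finset.sum_comm]
  simp_rw [← Finset.sum_smul, hAcol, one_smul]

theorem centroid_add (v w : Fin K → E) :
    (centroid fun k => v k + w k) = centroid v + centroid w := by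
  simp [centroid, Finset.sum_add_distrib]

theorem norm_centroid_le (v : Fin K → E) : ‖centroid v‖ ≤ (K : ℝ)⁻¹ * ∑ k, ‖v k‖ := by
  rw [centroid, norm_smul, norm_inv, Real.norm_natCast]
  gcongr
  exact norm_sum_le _ _

theorem norm_centroid_sub_centroid_le (v w : Fin K → E) :
    ‖centroid v - centroid w‖ ≤ (K : ℝ)⁻¹ * ∑ k, ‖v k - w k‖ := by
  have : centroid v - centroid w = centroid fun k => v k - w k := by
    simp [centroid, Finset.sum_sub_distrib, smul_sub]
  rw [this]
  exact norm_centroid_le _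

theorem norm_centroid_le_of_forall {v : Fin K → E} {c : ℝ} (hK : 0 < K) (h : ∀ k, ‖v k‖ ≤ c) :
    ‖centroid v‖ ≤ c := by
  have hK' : (0 : ℝ) < K := by exact_mod_cast hK
  refine (norm_centroid_le v).trans ?_
  rw [inv_mul_le_iff₀ hK']
  simpa using Finset.sum_le_card_nsmul Finset.univ (fun k => ‖v k‖) c fun k _ => h k

theorem norm_div_norm_smul {u : E} (hu : u ≠ 0) {μ : ℝ} (hμ : 0 ≤ μ) : ‖(μ / ‖u‖) • u‖ = μ := by
  rw [norm_smul, norm_div, norm_norm, Real.norm_of_nonneg hμ,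
    div_mul_cancel₀ _ (norm_ne_zero_iff.2 hu)]

/-- Correlation of the average of normalized directions with a given vector. -/
theorem mul_le_inner_centroid_normalized {F : Type*} [NormedAddCommGroup F]
    [InnerProductSpace ℝ F] (hK : 0 < K) {u : Fin K → F} (hu : ∀ k, u k ≠ 0) {μ : ℝ} (hμ : 0 ≤ μ)
    (g : F) :
    μ * (‖g‖ - 2 * ((K : ℝ)⁻¹ * ∑ k, ‖u k - g‖)) ≤ ⟪g, centroid fun k => (μ / ‖u k‖) • u k⟫ := by
  have hK' : (0 : ℝ) < K := by exact_mod_cast hK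
  have h : ∀ k, μ * (‖g‖ - 2 * ‖u k - g‖) ≤ ⟪g, (μ / ‖u k‖) • u k⟫ := fun k => by
    rw [div_eq_mul_inv, mul_smul, inner_smul_right]
    exact mul_le_mul_of_nonneg_left (norm_sub_two_mul_le_inner_normalized (hu k)) hμ
  have hsum := Finset.sum_le_sum fun k (_ : k ∈ Finset.univ) => h k
  rw [centroid, inner_smul_right, inner_sum, ← div_eq_inv_mul, ← div_eq_inv_mul, le_div_iff₀ hK']
  refine le_trans (le_of_eq ?_) hsum
  rw [← Finset.mul_sum, Finset.sum_sub_distrib, ← Finset.mul_sum]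
  simp
  field_simp

theorem inv_mul_sum_norm_sub_le (hK : 0 < K) (u : Fin K → E) (g : E) :
    (K : ℝ)⁻¹ * ∑ k, ‖u k - g‖ ≤ consensus u / √K + ‖centroid u - g‖ := by
  have hK' : (0 : ℝ) < K := by exact_mod_cast hK
  have h1 : ∑ k, ‖u k - g‖ ≤ ∑ k, ‖u k - centroid u‖ + K * ‖centroid u - g‖ := by
    have h := Finset.sum_le_sum fun k (_ : k ∈ Finset.univ) =>
      norm_sub_le_norm_sub_add_norm_sub (u k) (centroid u) g
    simpa [Finset.sum_add_distrib] using h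
  have h2 := inv_mul_sum_norm_le_stackDist hK u (fun _ => centroid u)
  calc (K : ℝ)⁻¹ * ∑ k, ‖u k - g‖
      ≤ (K : ℝ)⁻¹ * (∑ k, ‖u k - centroid u‖ + K * ‖centroid u - g‖) := by gcongr
    _ = (K : ℝ)⁻¹ * ∑ k, ‖u k - centroid u‖ + ‖centroid u - g‖ := by field_simp
    _ ≤ _ := by rw [consensus]; gcongr

end Network

theorem HasGradientAt.partial_fst {E F : Type*} [NormedAddCommGroup E] [InnerProductSpace ℝ E]
    [CompleteSpace E] [NormedAddCommGroup F] [InnerProductSpace ℝ F] [CompleteSpace F]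
    {f : E → F → ℝ} {gx x : E} {gy y : F}
    (h : HasGradientAt (fun z : WithLp 2 (E × F) => f (WithLp.equiv 2 _ z).1 (WithLp.equiv 2 _ z).2)
      ((WithLp.equiv 2 _).symm (gx, gy)) ((WithLp.equiv 2 _).symm (x, y))) :
    HasGradientAt (fun w => f w y) gx x := by
  have h1 : HasFDerivAt (fun w : E => (WithLp.equiv 2 (E × F)).symm (w, y))
      ((WithLp.prodContinuousLinearEquiv 2 ℝ E F).symm.toContinuousLinearMap.comp
        (ContinuousLinearMap.inl ℝ E F)) x :=
    (WithLp.prodContinuousLinearEquiv 2 ℝ E F).symm.toContinuousLinearMap.hasFDerivAt.comp x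
      (hasFDerivAt_prodMk_left x y)
  have h2 := HasFDerivAt.comp x h.hasFDerivAt h1
  refine (HasFDerivAt.congr_fderiv h2 ?_ : HasFDerivAt _ _ _)
  ext w
  simp [WithLp.prod_inner_apply]

theorem HasGradientAt.partial_snd {E F : Type*} [NormedAddCommGroup E] [InnerProductSpace ℝ E]
    [CompleteSpace E] [NormedAddCommGroup F] [InnerProductSpace ℝ F] [CompleteSpace F]
    {f : E → F → ℝ} {gx x : E} {gy y : F}
    (h : HasGradientAt (fun z : WithLp 2 (E × F) => f (WithLp.equiv 2 _ z).1 (WithLp.equiv 2 _ z).2)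
      ((WithLp.equiv 2 _).symm (gx, gy)) ((WithLp.equiv 2 _).symm (x, y))) :
    HasGradientAt (fun w => f x w) gy y := by
  have h1 : HasFDerivAt (fun w : F => (WithLp.equiv 2 (E × F)).symm (x, w))
      ((WithLp.prodContinuousLinearEquiv 2 ℝ E F).symm.toContinuousLinearMap.comp
        (ContinuousLinearMap.inr ℝ E F)) y :=
    (WithLp.prodContinuousLinearEquiv 2 ℝ E F).symm.toContinuousLinearMap.hasFDerivAt.comp y
      (hasFDerivAt_prodMk_right x y)
  have h2 := HasFDerivAt.comp y h.hasFDerivAt h1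
  refine (HasFDerivAt.congr_fderiv h2 ?_ : HasFDerivAt _ _ _)
  ext w
  simp [WithLp.prod_inner_apply]

theorem HasGradientAt.centroid {K : ℕ} {E : Type*} [NormedAddCommGroup E] [InnerProductSpace ℝ E]
    [CompleteSpace E] {f : Fin K → E → ℝ} {g : Fin K → E} {x : E}
    (h : ∀ k, HasGradientAt (f k) (g k) x) :
    HasGradientAt (fun w => (K : ℝ)⁻¹ * ∑ k, f k w) (centroid g) x := by
  have h1 := (HasFDerivAt.fun_sum (u := Finset.univ) fun k _ => (h k).hasFDerivAt).const_mul
    (K : ℝ)⁻¹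
  refine (HasFDerivAt.congr_fderiv h1 ?_ : HasFDerivAt _ _ _)
  simp [_root_.centroid]

/-- Centroid optimality-gap recursion for decentralized normalized diffusion
iterates under `L_f`-smoothness of the local costs, the `ν`-PL condition on
`J = (1/K)Σ_k J_k` with attained supremum, and `μ_x ≤ μ_y/(6κ)`. -/
theorem decentralized_centroid_optimality_gap
    (M₁ M₂ K : ℕ) (hM₁ : 0 < M₁) (hM₂ : 0 < M₂) (hK : 0 < K)
    (Lf ν μx μy : ℝ) (hLf : 0 < Lf) (hν : 0 < ν) (hμx : 0 < μx) (hμy : 0 < μy)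
    (Jk : Fin K → EuclideanSpace ℝ (Fin M₁) → EuclideanSpace ℝ (Fin M₂) → ℝ)
    (gxk : Fin K → EuclideanSpace ℝ (Fin M₁) → EuclideanSpace ℝ (Fin M₂) →
      EuclideanSpace ℝ (Fin M₁))
    (gyk : Fin K → EuclideanSpace ℝ (Fin M₁) → EuclideanSpace ℝ (Fin M₂) →
      EuclideanSpace ℝ (Fin M₂))
    (J : EuclideanSpace ℝ (Fin M₁) → EuclideanSpace ℝ (Fin M₂) → ℝ)
    (hJ : ∀ x y, J x y = (K : ℝ)⁻¹ * ∑ k, Jk k x y)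
    (hJdiffk : ∀ k x y,
      HasGradientAt
        (fun z : WithLp 2 (EuclideanSpace ℝ (Fin M₁) × EuclideanSpace ℝ (Fin M₂)) =>
          Jk k (WithLp.equiv 2 _ z).1 (WithLp.equiv 2 _ z).2)
        ((WithLp.equiv 2 _).symm (gxk k x y, gyk k x y)) ((WithLp.equiv 2 _).symm (x, y)))
    (hJlipk : ∀ k x₁ y₁ x₂ y₂,
      ‖gxk k x₁ y₁ - gxk k x₂ y₂‖ ^ 2 + ‖gyk k x₁ y₁ - gyk k x₂ y₂‖ ^ 2 ≤
        Lf ^ 2 * (‖x₁ - x₂‖ ^ 2 + ‖y₁ - y₂‖ ^ 2))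
    (hattain : ∀ x, ∃ y, ∀ y', J x y' ≤ J x y)
    (hPL : ∀ x y, 2 * ν * (Penv J x - J x y) ≤ ‖(K : ℝ)⁻¹ • ∑ k, gyk k x y‖ ^ 2)
    (A : Matrix (Fin K) (Fin K) ℝ) (hApos : ∀ k l, 0 ≤ A k l)
    (hArow : ∀ k, ∑ l, A k l = 1) (hAcol : ∀ l, ∑ k, A k l = 1)
    (x : Fin K → ℕ → EuclideanSpace ℝ (Fin M₁)) (y : Fin K → ℕ → EuclideanSpace ℝ (Fin M₂))
    (ux : Fin K → ℕ → EuclideanSpace ℝ (Fin M₁)) (uy : Fin K → ℕ → EuclideanSpace ℝ (Fin M₂))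
    (hux : ∀ k i, ux k i ≠ 0) (huy : ∀ k i, uy k i ≠ 0)
    (hxupd : ∀ k i, x k (i + 1) = ∑ l, A k l • (x l i - (μx / ‖ux l i‖) • ux l i))
    (hyupd : ∀ k i, y k (i + 1) = ∑ l, A k l • (y l i + (μy / ‖uy l i‖) • uy l i))
    (hstep : μx ≤ μy / (6 * (Lf / ν))) :
    ∀ i : ℕ,
      Metric.infDist (centroid fun k => y k (i + 1)) (argmaxY J (centroid fun k => x k (i + 1))) ≤
        (1 / 2) * Metric.infDist (centroid fun k => y k i) (argmaxY J (centroid fun k => x k i))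
        + 3 * ((Penv J (centroid fun k => x k i) - J (centroid fun k => x k i) (centroid fun k => y k i))
            - (Penv J (centroid fun k => x k (i + 1))
                - J (centroid fun k => x k (i + 1)) (centroid fun k => y k (i + 1)))) / (μy * ν)
        + (9 * (Lf / ν) / Real.sqrt K) *
            (consensus (fun k => x k i) + consensus (fun k => y k i))
        + (9 / ν) *
            ‖(K : ℝ)⁻¹ • ∑ k, uy k i - (K : ℝ)⁻¹ • ∑ k, gyk k (x k i) (y k i)‖
        + (9 / (Real.sqrt K * ν)) * consensus (fun k => uy k i)
        + (3 * (Lf / ν) * μy / 2 + μx / 4 + 19 * (Lf / ν) * μx / 2 + μy) := by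
  intro i
  have hK' : (0 : ℝ) < K := by exact_mod_cast hK
  have hgxLip : ∀ k a b a' b', ‖gxk k a b - gxk k a' b'‖ ≤ Lf * (‖a - a'‖ + ‖b - b'‖) := by
    intro k a b a' b'
    refine (abs_le_of_sq_le_sq' ?_ (by positivity)).2
    nlinarith [hJlipk k a b a' b', sq_nonneg ‖gyk k a b - gyk k a' b'‖, sq_nonneg Lf,
      mul_nonneg (sq_nonneg Lf) (mul_nonneg (norm_nonneg (a - a')) (norm_nonneg (b - b')))]
  have hgyLip : ∀ k a b a' b', ‖gyk k a b - gyk k a' b'‖ ≤ Lf * (‖a - a'‖ + ‖b - b'‖) := by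
    intro k a b a' b'
    refine (abs_le_of_sq_le_sq' ?_ (by positivity)).2
    nlinarith [hJlipk k a b a' b', sq_nonneg ‖gxk k a b - gxk k a' b'‖, sq_nonneg Lf,
      mul_nonneg (sq_nonneg Lf) (mul_nonneg (norm_nonneg (a - a')) (norm_nonneg (b - b')))]
  obtain rfl : J = fun a b => (K : ℝ)⁻¹ * ∑ k, Jk k a b := by funext a b; exact hJ a b
  have hxc : (centroid fun k => x k (i + 1)) =
      (centroid fun k => x k i) + centroid fun k => -((μx / ‖ux k i‖) • ux k i) := by
    simp_rw [hxupd, sub_eq_add_neg]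
    rw [centroid_doublyStochastic A hAcol, centroid_add]
  have hyc : (centroid fun k => y k (i + 1)) =
      (centroid fun k => y k i) + centroid fun k => (μy / ‖uy k i‖) • uy k i := by
    simp_rw [hyupd]
    rw [centroid_doublyStochastic A hAcol, centroid_add]
  have hgrad : ‖(centroid fun k => gyk k (x k i) (y k i)) -
      centroid fun k => gyk k (centroid fun k => x k i) (centroid fun k => y k i)‖ ≤
      Lf / √K * (consensus (fun k => x k i) + consensus (fun k => y k i)) := by
    refine (norm_centroid_sub_centroid_le _ _).trans ?_
    calc _ ≤ (K : ℝ)⁻¹ * ∑ k, Lf * (‖x k i - centroid fun k => x k i‖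
          + ‖y k i - centroid fun k => y k i‖) := by
            gcongr with k
            exact hgyLip _ _ _ _ _
      _ = Lf * ((K : ℝ)⁻¹ * ∑ k, ‖x k i - centroid fun k => x k i‖
          + (K : ℝ)⁻¹ * ∑ k, ‖y k i - centroid fun k => y k i‖) := by
            rw [← Finset.mul_sum, Finset.sum_add_distrib]; ring
      _ ≤ Lf * (consensus (fun k => x k i) / √K + consensus (fun k => y k i) / √K) := by
            gcongr
            · exact inv_mul_sum_norm_le_stackDist hK _ (fun _ => centroid fun k => x k i)
            · exact inv_mul_sum_norm_le_stackDist hK _ (fun _ => centroid fun k => y k i)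
      _ = _ := by ring
  have hmain := infDist_argmaxY_step
    (J := fun a b => (K : ℝ)⁻¹ * ∑ k, Jk k a b)
    (gx := fun a b => centroid fun k => gxk k a b)
    (gy := fun a b => centroid fun k => gyk k a b)
    (x := centroid fun k => x k i) (x' := centroid fun k => x k (i + 1))
    (y := centroid fun k => y k i) (y' := centroid fun k => y k (i + 1))
    (e := consensus (fun k => uy k i) / √K
      + ‖(centroid fun k => uy k i) - centroid fun k => gyk k (x k i) (y k i)‖
      + Lf / √K * (consensus (fun k => x k i) + consensus (fun k => y k i)))
    hLf hν hμy
    (fun a b => HasGradientAt.centroid fun k => (hJdiffk k a b).partial_fst)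
    (fun a b => HasGradientAt.centroid fun k => (hJdiffk k a b).partial_snd)
    (fun a b b' => by
      refine (norm_centroid_sub_centroid_le _ _).trans ?_
      rw [inv_mul_le_iff₀ hK']
      simpa using Finset.sum_le_card_nsmul Finset.univ _ _ fun k _ => hgxLip k a b a b')
    (fun a a' b => by
      refine (norm_centroid_sub_centroid_le _ _).trans ?_
      rw [inv_mul_le_iff₀ hK']
      simpa using Finset.sum_le_card_nsmul Finset.univ _ _ fun k _ => hgyLip k a b a' b)
    (fun a b b' => by
      refine (norm_centroid_sub_centroid_le _ _).trans ?_
      rw [inv_mul_le_iff₀ hK']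
      simpa using Finset.sum_le_card_nsmul Finset.univ _ _ fun k _ => hgyLip k a b a b')
    hattain hPL hstep
    (by
      rw [hxc, add_sub_cancel_left]
      exact norm_centroid_le_of_forall hK fun k => by
        rw [norm_neg, norm_div_norm_smul (hux k i) hμx.le])
    (by
      rw [hyc, add_sub_cancel_left]
      exact norm_centroid_le_of_forall hK fun k => (norm_div_norm_smul (huy k i) hμy.le).le)
    (fun g => by
      rw [hyc, add_sub_cancel_left]
      refine le_trans ?_ (mul_le_inner_centroid_normalized hK (fun k => huy k i) hμy.le g)
      have h1 := inv_mul_sum_norm_sub_le hK (fun k => uy k i) g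
      have h2 := norm_sub_le_norm_sub_add_norm_sub (centroid fun k => uy k i)
        (centroid fun k => gyk k (x k i) (y k i)) g
      have h3 := norm_sub_le_norm_sub_add_norm_sub (centroid fun k => gyk k (x k i) (y k i))
        (centroid fun k => gyk k (centroid fun k => x k i) (centroid fun k => y k i)) g
      refine mul_le_mul_of_nonneg_left ?_ hμy.le
      linarith)
  refine hmain.trans ?_
  have hsqrt : 0 < √(K : ℝ) := Real.sqrt_pos.2 hK'
  have hX : 0 ≤ consensus (fun k => x k i) := stackDist_nonneg _ _
  have hY : 0 ≤ consensus (fun k => y k i) := stackDist_nonneg _ _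
  have hU : 0 ≤ consensus (fun k => uy k i) := stackDist_nonneg _ _
  change _ ≤ _ + _ + _ + 9 / ν * ‖(centroid fun k => uy k i) -
    centroid fun k => gyk k (x k i) (y k i)‖ + _ + _
  set X := consensus (fun k => x k i) + consensus (fun k => y k i)
  set S := ‖(centroid fun k => uy k i) - centroid fun k => gyk k (x k i) (y k i)‖
  set U := consensus (fun k => uy k i)
  have hsplit : 6 * (U / √K + S + Lf / √K * X) / ν =
      6 * (Lf / ν / √K * X) + 6 * (S / ν) + 6 * (U / (√K * ν)) := by
    field_simp
    ring
  have e1 : 9 * (Lf / ν) / √K * X = 9 * (Lf / ν / √K * X) := by ring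
  have e2 : 9 / ν * S = 9 * (S / ν) := by ring
  have e3 : 9 / (√K * ν) * U = 9 * (U / (√K * ν)) := by ring
  have p1 : 0 ≤ Lf / ν / √K * X := by positivity
  have p2 : 0 ≤ S / ν := by positivity
  have p3 : 0 ≤ U / (√K * ν) := by positivity
  have p4 : 0 ≤ Lf / ν * μx := by positivity
  rw [hsplit, e1, e2, e3]
  linarith
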